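/- arXiv:2011.02244 — 2 statements merged into one kernel-verified Lean document; each statement's English description precedes it below -/
import Mathlib

section
/- Let p, q ∈ ℤ² with p∧q ≠ 0 and suppose q is of type I₀ relative to p. Then there exists ν₀ > 0 such that for every ν ∈ (0, ν₀) there exists λ > 0 for which the limits f(λ,ν) = lim_{k→∞}[a₁(λ,ν);…;a_k(λ,ν)] and g(λ,ν) = lim_{k→∞}[a_{−1}(λ,ν);…;a_{−k}(λ,ν)] exist and satisfy a₀(λ,ν) + f(λ,ν) + g(λ,ν) = 0. -/
open Filter Finset Topology

noncomputable section

/-- Squared Euclidean norm of an integer vector. -/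
def nsq (v : ℤ × ℤ) : ℝ := (v.1 : ℝ) ^ 2 + (v.2 : ℝ) ^ 2

/-- Wedge (cross) product of two integer vectors. -/
def wedge (p q : ℤ × ℤ) : ℤ := p.1 * q.2 - p.2 * q.1

/-- The lattice point `q + n • p`. -/
def pt (q p : ℤ × ℤ) (n : ℤ) : ℤ × ℤ := (q.1 + n * p.1, q.2 + n * p.2)

/-- ρ_n = 1 - ‖p‖²/‖q+np‖². -/
def rho (p q : ℤ × ℤ) (n : ℤ) : ℝ := 1 - nsq p / nsq (pt q p n)

/-- `q` is of type I₀ relative to `p`. -/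
def typeI0 (p q : ℤ × ℤ) : Prop :=
  nsq q < nsq p ∧ ∀ n : ℤ, n ≠ 0 → nsq p < nsq (pt q p n)

/-- a_n(λ,ν) = (λ + ν‖q+np‖²)/ρ_n. -/
def acoef (p q : ℤ × ℤ) (lam ν : ℝ) (n : ℤ) : ℝ :=
  (lam + ν * nsq (pt q p n)) / rho p q n

/-- Membership in the weighted space ℓ²_s(ℤ). -/
def memL2s (s : ℝ) (w : ℤ → ℝ) : Prop :=
  Summable fun n : ℤ => (1 + |(n : ℝ)| ^ (2 * s)) * (w n) ^ 2

/-- Finite continued fraction `[x₁; x₂; …; x_k] = 1/(x₁ + 1/(x₂ + ⋯ + 1/x_k))`. -/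
def cfL : List ℝ → ℝ
  | [] => 0
  | x :: xs => 1 / (x + cfL xs)

/-- partial continued fractions -/
def cK (a : ℕ → ℝ) (k : ℕ) : ℝ := cfL ((List.range k).map a)

/-- limit continued fraction -/
def cInf (a : ℕ → ℝ) : ℝ := limUnder atTop (cK a)

lemma cK_zero (a : ℕ → ℝ) : cK a 0 = 0 := by simp [cK, cfL]

lemma cK_succ (a : ℕ → ℝ) (k : ℕ) :
    cK a (k + 1) = 1 / (a 0 + cK (fun j => a (j + 1)) k) := by
  simp [cK, List.range_succ_eq_map, cfL, Function.comp_def]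

lemma cK_nonneg (k : ℕ) : ∀ a : ℕ → ℝ, (∀ j, 0 < a j) → 0 ≤ cK a k := by
  induction k with
  | zero => intro a _; rw [cK_zero]
  | succ k ih =>
    intro a ha
    rw [cK_succ]
    have h1 := ih (fun j => a (j + 1)) (fun j => ha _)
    have h2 := ha 0
    positivity

lemma cK_le (a : ℕ → ℝ) (ε : ℝ) (hε : 0 < ε) (ha : ∀ j, ε ≤ a j) (k : ℕ) :
    cK a k ≤ 1 / ε := by
  cases k with
  | zero => rw [cK_zero]; positivity
  | succ k =>
    rw [cK_succ]
    have h1 := cK_nonneg k (fun j => a (j + 1)) (fun j => hε.trans_le (ha _))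
    have h2 := ha 0
    apply one_div_le_one_div_of_le hε
    linarith

lemma contr (ε a b x y : ℝ) (hε : 0 < ε) (ha : ε ≤ a) (hb : ε ≤ b) (hx : 0 ≤ x) (hy : 0 ≤ y) :
    |1 / (a + 1 / (b + x)) - 1 / (a + 1 / (b + y))| ≤ (1 / (1 + ε ^ 2)) * |x - y| := by
  have ha0 : 0 < a := hε.trans_le ha
  have hb0 : 0 < b := hε.trans_le hb
  have hbx : 0 < b + x := by linarith
  have hby : 0 < b + y := by linarith
  have h : 1 / (a + 1 / (b + x)) - 1 / (a + 1 / (b + y))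
      = (1 / ((a * (b + x) + 1) * (a * (b + y) + 1))) * (x - y) := by
    have h1 : a * (b + x) + 1 ≠ 0 := by positivity
    have h2 : a * (b + y) + 1 ≠ 0 := by positivity
    have e1 : 1 / (a + 1 / (b + x)) = (b + x) / (a * (b + x) + 1) := by
      field_simp
    have e2 : 1 / (a + 1 / (b + y)) = (b + y) / (a * (b + y) + 1) := by
      field_simp
    rw [e1, e2]
    field_simp
    ring
  rw [h, abs_mul, abs_of_pos (by positivity : 0 < 1 / ((a * (b + x) + 1) * (a * (b + y) + 1)))]
  apply mul_le_mul_of_nonneg_right _ (abs_nonneg _)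
  apply one_div_le_one_div_of_le (by positivity)
  have h3 : ε ^ 2 ≤ a * (b + x) := by nlinarith [mul_nonneg ha0.le hx]
  have h4 : 0 ≤ a * (b + y) := by positivity
  nlinarith [sq_nonneg ε]

lemma cK_diff (ε : ℝ) (hε : 0 < ε) (i k : ℕ) : ∀ a : ℕ → ℝ, (∀ j, ε ≤ a j) →
    |cK a (i + 2 * k) - cK a (2 * k)| ≤ (1 / (1 + ε ^ 2)) ^ k * (1 / ε) := by
  induction k with
  | zero =>
    intro a ha
    simp only [mul_zero, add_zero, cK_zero, sub_zero, pow_zero, one_mul]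
    rw [abs_of_nonneg (cK_nonneg i a fun j => hε.trans_le (ha j))]
    exact cK_le a ε hε ha i
  | succ k ih =>
    intro a ha
    have e1 : i + 2 * (k + 1) = (i + 2 * k) + 1 + 1 := by ring
    have e2 : 2 * (k + 1) = 2 * k + 1 + 1 := by ring
    rw [e1, e2, cK_succ, cK_succ, cK_succ, cK_succ]
    have hp : ∀ j, ε ≤ a (j + 1 + 1) := fun j => ha _
    have := ih _ hp
    refine (contr ε _ _ _ _ hε (ha _) (ha _)
      (cK_nonneg _ _ fun j => hε.trans_le (hp j)) (cK_nonneg _ _ fun j => hε.trans_le (hp j))).trans ?_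
    rw [pow_succ (1 / (1 + ε ^ 2)) k, mul_comm (_ ^ k), mul_assoc]
    exact mul_le_mul_of_nonneg_left this (by positivity)

lemma rate_tendsto (ε : ℝ) (hε : 0 < ε) :
    Tendsto (fun k : ℕ => (1 / (1 + ε ^ 2)) ^ k * (1 / ε)) atTop (𝓝 0) := by
  have h : Tendsto (fun k : ℕ => (1 / (1 + ε ^ 2)) ^ k) atTop (𝓝 0) := by
    apply tendsto_pow_atTop_nhds_zero_of_lt_one (by positivity)
    rw [div_lt_one (by positivity)]
    nlinarith [pow_pos hε 2]
  simpa using h.mul_const (1 / ε)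

lemma cK_tendsto (a : ℕ → ℝ) (ε : ℝ) (hε : 0 < ε) (ha : ∀ j, ε ≤ a j) :
    Tendsto (cK a) atTop (𝓝 (cInf a)) := by
  have hc : CauchySeq (cK a) := by
    rw [Metric.cauchySeq_iff']
    intro δ hδ
    obtain ⟨k, hk⟩ := ((rate_tendsto ε hε).eventually (gt_mem_nhds hδ)).exists
    refine ⟨2 * k, fun n hn => ?_⟩
    obtain ⟨i, rfl⟩ := Nat.exists_eq_add_of_le' hn
    rw [Real.dist_eq]
    exact (cK_diff ε hε i k a ha).trans_lt hk
  exact tendsto_nhds_limUnder (cauchySeq_tendsto_of_complete hc)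

lemma cInf_nonneg (a : ℕ → ℝ) (ε : ℝ) (hε : 0 < ε) (ha : ∀ j, ε ≤ a j) : 0 ≤ cInf a :=
  ge_of_tendsto' (cK_tendsto a ε hε ha) fun k => cK_nonneg k a fun j => hε.trans_le (ha j)

lemma cInf_le (a : ℕ → ℝ) (ε : ℝ) (hε : 0 < ε) (ha : ∀ j, ε ≤ a j) : cInf a ≤ 1 / ε :=
  le_of_tendsto' (cK_tendsto a ε hε ha) fun k => cK_le a ε hε ha k

lemma cInf_diff (a : ℕ → ℝ) (ε : ℝ) (hε : 0 < ε) (ha : ∀ j, ε ≤ a j) (k : ℕ) :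
    |cInf a - cK a (2 * k)| ≤ (1 / (1 + ε ^ 2)) ^ k * (1 / ε) := by
  have h := ((tendsto_add_atTop_iff_nat (2 * k)).2 (cK_tendsto a ε hε ha)).sub_const (cK a (2 * k))
  exact le_of_tendsto' h.abs fun i => cK_diff ε hε i k a ha

lemma cInf_succ (a : ℕ → ℝ) (ε : ℝ) (hε : 0 < ε) (ha : ∀ j, ε ≤ a j) :
    cInf a = 1 / (a 0 + cInf (fun j => a (j + 1))) := by
  have h1 := (tendsto_add_atTop_iff_nat 1).2 (cK_tendsto a ε hε ha)
  have h2 := cK_tendsto (fun j => a (j + 1)) ε hε (fun j => ha _)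
  have h0 := cInf_nonneg (fun j => a (j + 1)) ε hε (fun j => ha _)
  have h3 : Tendsto (fun k => 1 / (a 0 + cK (fun j => a (j + 1)) k)) atTop
      (𝓝 (1 / (a 0 + cInf (fun j => a (j + 1))))) := by
    apply Tendsto.div tendsto_const_nhds (h2.const_add _)
    have := ha 0
    linarith
  refine tendsto_nhds_unique h1 (h3.congr fun k => ?_)
  rw [cK_succ]

lemma cK_cont (S : Set ℝ) (k : ℕ) : ∀ a : ℝ → ℕ → ℝ, (∀ j, ContinuousOn (fun x => a x j) S) →
    (∀ x ∈ S, ∀ j, 0 < a x j) → ContinuousOn (fun x => cK (a x) k) S := by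
  induction k with
  | zero => intro a _ _; simp only [cK_zero]; exact continuousOn_const
  | succ k ih =>
    intro a hc hp
    simp only [cK_succ]
    apply ContinuousOn.div continuousOn_const
    · exact (hc 0).add (ih (fun x j => a x (j + 1)) (fun j => hc _) (fun x hx j => hp x hx _))
    · intro x hx
      have h1 := cK_nonneg k (fun j => a x (j + 1)) (fun j => hp x hx _)
      have h2 := hp x hx 0
      positivity

lemma cInf_cont (S : Set ℝ) (a : ℝ → ℕ → ℝ) (ε : ℝ) (hε : 0 < ε)
    (hc : ∀ j, ContinuousOn (fun x => a x j) S) (hp : ∀ x ∈ S, ∀ j, ε ≤ a x j) :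
    ContinuousOn (fun x => cInf (a x)) S := by
  have hu : TendstoUniformlyOn (fun k x => cK (a x) (2 * k)) (fun x => cInf (a x)) atTop S := by
    rw [Metric.tendstoUniformlyOn_iff]
    intro δ hδ
    filter_upwards [(rate_tendsto ε hε).eventually (gt_mem_nhds hδ)] with k hk x hx
    rw [Real.dist_eq]
    exact (cInf_diff (a x) ε hε (hp x hx) k).trans_lt hk
  exact hu.continuousOn (Frequently.of_forall fun k =>
    cK_cont S _ a hc fun x hx j => hε.trans_le (hp x hx j))

lemma cInf_lower (k : ℕ) : ∀ b : ℕ → ℝ, (∀ j, 2 ≤ b j) →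
    ∃ δ > (0 : ℝ), ∀ ν : ℝ, 0 < ν → ν < δ → k * ν ≤ cInf (fun j => ν * b j) := by
  induction k with
  | zero =>
    intro b hb
    refine ⟨1, one_pos, fun ν hν _ => ?_⟩
    simp only [Nat.cast_zero, zero_mul]
    exact cInf_nonneg _ ν hν fun j => by nlinarith [hb j]
  | succ k ih =>
    intro b hb
    obtain ⟨δ, hδ, h⟩ := ih (fun j => b (j + 1 + 1)) (fun j => hb _)
    have hb0 : 0 < b 0 := by linarith [hb 0]
    have hM : 0 < b 0 * ((k : ℝ) + 1) * ((k : ℝ) + 2) := by positivity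
    refine ⟨min δ (min 1 (1 / (b 0 * ((k : ℝ) + 1) * ((k : ℝ) + 2)))), by positivity,
      fun ν hν hlt => ?_⟩
    have hνδ : ν < δ := hlt.trans_le (min_le_left _ _)
    have hν1 : ν < 1 := hlt.trans_le ((min_le_right _ _).trans (min_le_left _ _))
    have hν2 : ν < 1 / (b 0 * ((k : ℝ) + 1) * ((k : ℝ) + 2)) :=
      hlt.trans_le ((min_le_right _ _).trans (min_le_right _ _))
    rw [lt_div_iff₀ hM] at hν2
    have hx := h ν hν hνδ
    have hge : ∀ j, ν ≤ ν * b j := fun j => by nlinarith [hb j]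
    rw [cInf_succ _ ν hν hge, cInf_succ _ ν hν (fun j => hge _)]
    set x := cInf (fun j => ν * b (j + 1 + 1)) with hxdef
    have hy : ((k : ℝ) + 2) * ν ≤ ν * b (0 + 1) + x := by nlinarith [hb (0 + 1)]
    have hk0 : 0 < ((k : ℝ) + 2) * ν := by positivity
    have h1 : 1 / (ν * b (0 + 1) + x) ≤ 1 / (((k : ℝ) + 2) * ν) :=
      one_div_le_one_div_of_le hk0 hy
    have hypos : 0 < 1 / (ν * b (0 + 1) + x) := by
      have := hk0.trans_le hy
      positivity
    rw [le_div_iff₀ (by positivity)]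
    push_cast
    have hν3 : ν * ν * (b 0 * ((k : ℝ) + 1) * ((k : ℝ) + 2)) ≤ 1 := by nlinarith
    calc ((k : ℝ) + 1) * ν * (ν * b 0 + 1 / (ν * b (0 + 1) + x))
        ≤ ((k : ℝ) + 1) * ν * (ν * b 0 + 1 / (((k : ℝ) + 2) * ν)) := by gcongr
      _ = (ν * ν * (b 0 * ((k : ℝ) + 1) * ((k : ℝ) + 2)) + (k + 1)) / (k + 2) := by
          field_simp
      _ ≤ 1 := by
          rw [div_le_one (by positivity)]
          linarith

lemma nsq_q_ge (p q : ℤ × ℤ) (hpq : wedge p q ≠ 0) : 1 ≤ nsq q := by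
  have h : 0 < q.1 ^ 2 + q.2 ^ 2 := by
    by_contra hn
    have h1 : q.1 = 0 := by nlinarith [sq_nonneg q.1, sq_nonneg q.2]
    have h2 : q.2 = 0 := by nlinarith [sq_nonneg q.1, sq_nonneg q.2]
    apply hpq
    simp [wedge, h1, h2]
  have h' : 1 ≤ q.1 ^ 2 + q.2 ^ 2 := h
  unfold nsq
  exact_mod_cast h'

/-- For type I₀ points and sufficiently small viscosity, the continued fraction
equation `a₀(λ,ν) + f(λ,ν) + g(λ,ν) = 0` has a positive root `λ > 0`. -/
theorem continuedFraction_equation_has_positive_root_typeI0 (p q : ℤ × ℤ)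
    (hpq : wedge p q ≠ 0) (hI0 : typeI0 p q) :
    ∃ ν₀ > (0 : ℝ), ∀ ν : ℝ, 0 < ν → ν < ν₀ →
      ∃ lam > (0 : ℝ), ∃ F G : ℝ,
        Tendsto (fun k : ℕ =>
            cfL ((List.range k).map fun j => acoef p q lam ν (1 + (j : ℤ))))
          atTop (nhds F) ∧
        Tendsto (fun k : ℕ =>
            cfL ((List.range k).map fun j => acoef p q lam ν (-1 - (j : ℤ))))
          atTop (nhds G) ∧
        acoef p q lam ν 0 + F + G = 0 := by
  have hq1 := nsq_q_ge p q hpq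
  obtain ⟨hlt, hn⟩ := hI0
  have hpt0 : pt q p 0 = q := by simp [pt]
  have hr0 : rho p q 0 < 0 := by
    unfold rho
    rw [hpt0, sub_neg, one_lt_div (by linarith)]
    exact hlt
  have hrpos : ∀ n : ℤ, n ≠ 0 → 0 < rho p q n := fun n h0 => by
    unfold rho
    have := hn n h0
    rw [sub_pos, div_lt_one (by linarith)]
    exact this
  have hrle : ∀ n : ℤ, n ≠ 0 → rho p q n ≤ 1 := fun n h0 => by
    unfold rho
    have := hn n h0
    have h2 : 0 ≤ nsq p / nsq (pt q p n) := div_nonneg (by linarith) (by linarith)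
    linarith
  have hb : ∀ n : ℤ, n ≠ 0 → 2 ≤ (1 + nsq (pt q p n)) / rho p q n := fun n h0 => by
    rw [le_div_iff₀ (hrpos n h0)]
    linarith [hn n h0, hrle n h0]
  have hge : ∀ n : ℤ, n ≠ 0 → ∀ lam ν : ℝ, 0 < ν → ν ≤ lam → ν ≤ acoef p q lam ν n :=
    fun n h0 lam ν hν hl => by
      unfold acoef
      rw [le_div_iff₀ (hrpos n h0)]
      nlinarith [hn n h0, hrle n h0, hrpos n h0]
  have hcont : ∀ (n : ℤ) (ν : ℝ) (S : Set ℝ), ContinuousOn (fun lam => acoef p q lam ν n) S := by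
    intro n ν S
    unfold acoef
    fun_prop
  have hscale : ∀ (n : ℤ) (ν : ℝ),
      acoef p q ν ν n = ν * ((1 + nsq (pt q p n)) / rho p q n) := by
    intro n ν
    unfold acoef
    ring
  have hn1 : ∀ j : ℕ, (1 + (j : ℤ)) ≠ 0 := fun j => by omega
  have hn2 : ∀ j : ℕ, (-1 - (j : ℤ)) ≠ 0 := fun j => by omega
  obtain ⟨k, hk⟩ := exists_nat_ge (-((1 + nsq (pt q p 0)) / rho p q 0))
  obtain ⟨δ, hδ, hlow⟩ := cInf_lower k
    (fun j => (1 + nsq (pt q p (1 + (j : ℤ)))) / rho p q (1 + (j : ℤ))) (fun j => hb _ (hn1 j))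
  refine ⟨δ, hδ, fun ν hν hνδ => ?_⟩
  set A : ℝ → ℕ → ℝ := fun lam j => acoef p q lam ν (1 + (j : ℤ)) with hA
  set B : ℝ → ℕ → ℝ := fun lam j => acoef p q lam ν (-1 - (j : ℤ)) with hB
  have hAge : ∀ lam, ν ≤ lam → ∀ j, ν ≤ A lam j := fun lam hl j => hge _ (hn1 j) lam ν hν hl
  have hBge : ∀ lam, ν ≤ lam → ∀ j, ν ≤ B lam j := fun lam hl j => hge _ (hn2 j) lam ν hν hl
  set L : ℝ := ν + 2 * (-rho p q 0) / ν with hL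
  have hνL : ν ≤ L := by
    have : 0 ≤ 2 * (-rho p q 0) / ν := div_nonneg (by linarith) hν.le
    linarith
  have hH : ContinuousOn (fun lam => acoef p q lam ν 0 + cInf (A lam) + cInf (B lam))
      (Set.Icc ν L) := by
    refine ((hcont 0 ν _).add ?_).add ?_
    · exact cInf_cont _ A ν hν (fun j => hcont _ ν _) fun x hx => hAge x hx.1
    · exact cInf_cont _ B ν hν (fun j => hcont _ ν _) fun x hx => hBge x hx.1
  have hleft : 0 ≤ acoef p q ν ν 0 + cInf (A ν) + cInf (B ν) := by
    have h1 := hlow ν hν hνδ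
    have h2 := cInf_nonneg (B ν) ν hν (hBge ν le_rfl)
    have h3 : A ν = fun j : ℕ => ν * ((1 + nsq (pt q p (1 + (j : ℤ)))) / rho p q (1 + (j : ℤ))) := by
      funext j
      exact hscale _ ν
    rw [← h3] at h1
    rw [hscale]
    nlinarith
  have hright : acoef p q L ν 0 + cInf (A L) + cInf (B L) ≤ 0 := by
    have h1 := cInf_le (A L) ν hν (hAge L hνL)
    have h2 := cInf_le (B L) ν hν (hBge L hνL)
    have h3 : acoef p q L ν 0 ≤ -(2 / ν) := by
      unfold acoef
      rw [div_le_iff_of_neg hr0, hpt0, hL]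
      have e : -(2 / ν) * rho p q 0 = 2 * (-rho p q 0) / ν := by ring
      rw [e]
      nlinarith
    have e : 2 / ν = 1 / ν + 1 / ν := by ring
    linarith
  obtain ⟨lam, hlam, h0⟩ := intermediate_value_Icc' hνL hH ⟨hright, hleft⟩
  have hc1 : ∀ (k : ℕ) (f : ℤ → ℝ), cK (fun j : ℕ => f (j : ℤ)) k =
      cfL (List.map f (do let a ← List.range k; pure (a : ℤ))) := by
    intro k f
    unfold cK
    congr 1
    induction List.range k with
    | nil => simp
    | cons x xs ih => simpa using ih
  refine ⟨lam, hν.trans_le hlam.1, cInf (A lam), cInf (B lam), ?_, ?_, h0⟩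
  · exact (cK_tendsto (A lam) ν hν (hAge lam hlam.1)).congr
      fun k => hc1 k (fun j => acoef p q lam ν (1 + j))
  · exact (cK_tendsto (B lam) ν hν (hBge lam hlam.1)).congr
      fun k => hc1 k (fun j => acoef p q lam ν (-1 - j))
end
end

section
/- Let p, q ∈ ℤ² with p∧q ≠ 0 and set b_n = ‖q+np‖⁴/(‖q+np‖² − ‖p‖²) whenever ‖q+np‖ ≠ ‖p‖. (a) If q is of type I₊ relative to p, then for every ν > 0 the limit G(ν) = lim_{k→∞}[νb_{−1}; νb_{−2}; …; νb_{−k}] exists and there exists ν₀ᵖ > 0 such that for all ν ∈ (0, ν₀ᵖ), G(ν) > ν‖q‖⁴/(‖p‖² − ‖q‖²). (b) If q is of type I₋ relative to p, then for every ν > 0 the limit F(ν) = lim_{k→∞}[νb₁; νb₂; …; νb_k] exists and there exists ν₀ᵐ > 0 such that for all ν ∈ (0, ν₀ᵐ), F(ν) > ν‖q‖⁴/(‖p‖² − ‖q‖²). -/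
open Filter Finset Topology

noncomputable section

/-- `q` is of type I₊ relative to `p`. -/
def typeIp (p q : ℤ × ℤ) : Prop :=
  nsq q < nsq p ∧ nsq (pt q p 1) = nsq p ∧
    ∀ n : ℤ, n ≠ 0 → n ≠ 1 → nsq p < nsq (pt q p n)

/-- `q` is of type I₋ relative to `p`. -/
def typeIm (p q : ℤ × ℤ) : Prop :=
  nsq q < nsq p ∧ nsq (pt q p (-1)) = nsq p ∧
    ∀ n : ℤ, n ≠ 0 → n ≠ -1 → nsq p < nsq (pt q p n)

/-- b_n = ‖q+np‖⁴/(‖q+np‖² − ‖p‖²). -/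
def bcoef (p q : ℤ × ℤ) (n : ℤ) : ℝ :=
  (nsq (pt q p n)) ^ 2 / (nsq (pt q p n) - nsq p)

def Cf (x : ℕ → ℝ) (k : ℕ) : ℝ := cfL ((List.range k).map x)

lemma Cf_zero (x : ℕ → ℝ) : Cf x 0 = 0 := by simp [Cf, cfL]

lemma Cf_succ (x : ℕ → ℝ) (k : ℕ) :
    Cf x (k + 1) = 1 / (x 0 + Cf (fun j => x (j + 1)) k) := by
  simp [Cf, cfL, List.range_succ_eq_map, Function.comp_def]

lemma Cf_bounds {d : ℝ} (hd : 0 < d) (k : ℕ) :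
    ∀ x : ℕ → ℝ, (∀ j, d ≤ x j) → 0 ≤ Cf x k ∧ Cf x k ≤ 1 / d := by
  induction k with
  | zero => intro x _; rw [Cf_zero]; exact ⟨le_rfl, by positivity⟩
  | succ k ih =>
    intro x hx
    have h := (ih (fun j => x (j + 1)) (fun j => hx _)).1
    have h0 := hx 0
    rw [Cf_succ]
    refine ⟨by apply div_nonneg <;> linarith, ?_⟩
    apply one_div_le_one_div_of_le hd
    linarith

lemma two_step {x y s : ℝ} (hx : 0 < x) (hy : 0 < y) (hs : 0 ≤ s) :
    1 / (x + 1 / (y + s)) = (y + s) / (1 + x * (y + s)) := by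
  have : 0 < y + s := by linarith
  have : 0 < 1 + x * (y + s) := by positivity
  field_simp
  ring

lemma contr_s10 {d x y s t : ℝ} (hd : 0 < d) (hx : d ≤ x) (hy : d ≤ y) (hs : 0 ≤ s) (ht : 0 ≤ t) :
    |1 / (x + 1 / (y + s)) - 1 / (x + 1 / (y + t))| ≤ (1 / (1 + d ^ 2)) * |s - t| := by
  have hx0 : 0 < x := by linarith
  have hy0 : 0 < y := by linarith
  have aux : ∀ u : ℝ, 0 ≤ u → 1 + d ^ 2 ≤ 1 + x * (y + u) := by
    intro u hu
    have : d * d ≤ x * (y + u) := mul_le_mul hx (by linarith) hd.le hx0.le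
    nlinarith
  have h1 := aux s hs
  have h2 := aux t ht
  have hd2 : 0 < 1 + d ^ 2 := by positivity
  have p1 : 0 < 1 + x * (y + s) := by linarith
  have p2 : 0 < 1 + x * (y + t) := by linarith
  rw [two_step hx0 hy0 hs, two_step hx0 hy0 ht]
  have e : (y + s) / (1 + x * (y + s)) - (y + t) / (1 + x * (y + t)) =
      (1 / ((1 + x * (y + s)) * (1 + x * (y + t)))) * (s - t) := by
    field_simp
    ring
  rw [e, abs_mul, abs_of_pos (by positivity)]
  apply mul_le_mul_of_nonneg_right _ (abs_nonneg _)
  apply one_div_le_one_div_of_le hd2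
  calc 1 + d ^ 2 = (1 + d ^ 2) * 1 := by ring
    _ ≤ _ := mul_le_mul h1 (by nlinarith) zero_le_one p1.le

lemma Cf_diff {d : ℝ} (hd : 0 < d) (m : ℕ) :
    ∀ x : ℕ → ℝ, (∀ j, d ≤ x j) → ∀ i j : ℕ,
      |Cf x (i + 2 * m) - Cf x (j + 2 * m)| ≤ (1 / (1 + d ^ 2)) ^ m * (1 / d) := by
  induction m with
  | zero =>
    intro x hx i j
    have h1 := Cf_bounds hd (i + 2 * 0) x hx
    have h2 := Cf_bounds hd (j + 2 * 0) x hx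
    rw [pow_zero, one_mul, abs_le]
    constructor <;> linarith
  | succ m ih =>
    intro x hx i j
    have e : ∀ i : ℕ, i + 2 * (m + 1) = (i + 2 * m) + 1 + 1 := fun i => by ring
    rw [e, e, Cf_succ, Cf_succ, Cf_succ x, Cf_succ]
    have hx2 : ∀ j, d ≤ (fun j => x (j + 1 + 1)) j := fun j => hx _
    refine (contr_s10 hd (hx 0) (hx (0 + 1)) (Cf_bounds hd _ _ hx2).1 (Cf_bounds hd _ _ hx2).1).trans ?_
    rw [pow_succ' (1 / (1 + d ^ 2)) m, mul_assoc]
    exact mul_le_mul_of_nonneg_left (ih _ hx2 i j) (by positivity)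

lemma Cf_conv {d : ℝ} (hd : 0 < d) (x : ℕ → ℝ) (hx : ∀ j, d ≤ x j) :
    ∃ g, Tendsto (Cf x) atTop (nhds g) := by
  apply cauchySeq_tendsto_of_complete
  rw [Metric.cauchySeq_iff]
  intro ε hε
  have hr : 1 / (1 + d ^ 2) < 1 := by
    rw [div_lt_one (by positivity)]
    have : 0 < d ^ 2 := by positivity
    linarith
  obtain ⟨m, hm⟩ := exists_pow_lt_of_lt_one (show 0 < ε * d by positivity) hr
  refine ⟨2 * m, fun i hi j hj => ?_⟩
  obtain ⟨i, rfl⟩ := Nat.exists_eq_add_of_le' hi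
  obtain ⟨j, rfl⟩ := Nat.exists_eq_add_of_le' hj
  rw [Real.dist_eq]
  refine (Cf_diff hd m x hx i j).trans_lt ?_
  rw [mul_one_div, div_lt_iff₀ hd]
  exact hm

lemma Cf_lower {P : ℝ} (hP : 0 < P) (m : ℕ) :
    ∀ b : ℕ → ℝ, (∀ j, P ≤ b j) → ∃ ν₀ > (0 : ℝ), ∀ ν : ℝ, 0 < ν → ν < ν₀ →
      ∀ k : ℕ, ν * (m * (P / 2)) ≤ Cf (fun j => ν * b j) (k + 2 * m) := by
  induction m with
  | zero =>
    intro b hb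
    refine ⟨1, one_pos, fun ν hν _ k => ?_⟩
    have := (Cf_bounds (mul_pos hν hP) (k + 2 * 0) (fun j => ν * b j)
      (fun j => mul_le_mul_of_nonneg_left (hb j) hν.le)).1
    simpa using this
  | succ m ih =>
    intro b hb
    obtain ⟨ν₁, h1, h⟩ := ih (fun j => b (j + 1 + 1)) (fun j => hb _)
    have hb0 : 0 < b 0 := hP.trans_le (hb 0)
    have hb1 : 0 < b 1 := hP.trans_le (hb 1)
    set B : ℝ := m * (P / 2) with hB
    have hB0 : 0 ≤ B := by positivity
    -- need (B + P/2)(1 + ν² b0 (b1+B)) ≤ b1 + B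
    set K : ℝ := (B + P / 2) * (b 0 * (b 1 + B)) with hK
    have hK0 : 0 < K := by positivity
    refine ⟨min ν₁ (min 1 (P / 2 / K)), by positivity, fun ν hν hlt k => ?_⟩
    obtain ⟨l1, l2⟩ := lt_min_iff.1 hlt
    obtain ⟨l2, l3⟩ := lt_min_iff.1 l2
    rw [lt_div_iff₀ hK0] at l3
    have hh := h ν hν l1 k
    have e : k + 2 * (m + 1) = (k + 2 * m) + 1 + 1 := by ring
    rw [e, Cf_succ, Cf_succ]
    set s := Cf (fun j => ν * b (j + 1 + 1)) (k + 2 * m) with hs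
    have hνB : 0 ≤ ν * B := by positivity
    have step : 1 / (ν * b 0 + 1 / (ν * b 1 + ν * B)) ≤ 1 / (ν * b 0 + 1 / (ν * b (0 + 1) + s)) := by
      have q1 : 0 < ν * b 1 := by positivity
      have q0 : 0 < ν * b 0 := by positivity
      have q2 : 0 < ν * b 1 + s := by linarith
      have q3 : 1 / (ν * b 1 + s) ≤ 1 / (ν * b 1 + ν * B) :=
        one_div_le_one_div_of_le (by linarith) (by linarith)
      have q4 : 0 < 1 / (ν * b 1 + s) := by positivity
      simp only [zero_add]
      exact one_div_le_one_div_of_le (by linarith) (by linarith)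
    refine le_trans ?_ step
    rw [two_step (by positivity) (by positivity) hνB, le_div_iff₀ (by positivity)]
    have e2 : ((m + 1 : ℕ) : ℝ) * (P / 2) = B + P / 2 := by rw [hB]; push_cast; ring
    rw [e2]
    have hkey : (B + P / 2) + ν ^ 2 * K ≤ b 1 + B := by
      have : ν ^ 2 * K ≤ ν * K := by
        apply mul_le_mul_of_nonneg_right _ hK0.le
        nlinarith
      have := hb 1
      linarith
    calc ν * (B + P / 2) * (1 + ν * b 0 * (ν * b 1 + ν * B))
        = ν * ((B + P / 2) + ν ^ 2 * K) := by rw [hK]; ring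
      _ ≤ ν * (b 1 + B) := mul_le_mul_of_nonneg_left hkey hν.le
      _ = _ := by ring

lemma Cf_key {P : ℝ} (hP : 0 < P) (b : ℕ → ℝ) (hb : ∀ j, P ≤ b j) (A : ℝ) :
    ∃ G : ℝ → ℝ, (∀ ν : ℝ, 0 < ν → Tendsto (fun k : ℕ =>
        cfL ((List.range k).map fun j => ν * b j)) atTop (nhds (G ν))) ∧
      ∃ ν₀ > (0 : ℝ), ∀ ν : ℝ, 0 < ν → ν < ν₀ → G ν > ν * A := by
  have hex : ∀ ν : ℝ, ∃ g, 0 < ν → Tendsto (Cf fun j => ν * b j) atTop (nhds g) := by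
    intro ν
    by_cases hν : 0 < ν
    · obtain ⟨g, hg⟩ := Cf_conv (mul_pos hν hP) (fun j => ν * b j)
        (fun j => mul_le_mul_of_nonneg_left (hb j) hν.le)
      exact ⟨g, fun _ => hg⟩
    · exact ⟨0, fun h => absurd h hν⟩
  choose G hG using hex
  refine ⟨G, hG, ?_⟩
  obtain ⟨m, hm⟩ := exists_nat_gt (A / (P / 2))
  rw [div_lt_iff₀ (by positivity)] at hm
  obtain ⟨ν₀, h0, h⟩ := Cf_lower hP m b hb
  refine ⟨ν₀, h0, fun ν hν hlt => ?_⟩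
  have : ν * (m * (P / 2)) ≤ G ν := by
    refine ge_of_tendsto (hG ν hν) ?_
    filter_upwards [eventually_ge_atTop (2 * m)] with k hk
    obtain ⟨k, rfl⟩ := Nat.exists_eq_add_of_le' hk
    exact h ν hν hlt k
  exact (mul_lt_mul_of_pos_left hm hν).trans_le this

lemma bcoef_ge {p q : ℤ × ℤ} (hP : 0 < nsq p) {n : ℤ} (h : nsq p < nsq (pt q p n)) :
    nsq p ≤ bcoef p q n := by
  unfold bcoef
  rw [le_div_iff₀ (by linarith)]
  nlinarith

lemma lift_list (f : ℤ → ℝ) (k : ℕ) :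
    List.map f (do
      let a ← List.range k
      pure (a : ℤ)) = (List.range k).map fun j : ℕ => f (j : ℤ) := by
  simp only [List.bind_eq_flatMap, List.pure_def, List.map_flatMap, List.map_cons, List.map_nil]
  exact List.flatMap_pure_eq_map _ _

/-- For type I₊ (resp. I₋) points, the one-sided continued fraction `G(ν)`
(resp. `F(ν)`) exists for every `ν > 0` and dominates the line
`ν‖q‖⁴/(‖p‖² − ‖q‖²)` for all sufficiently small `ν`. -/
theorem continuedFraction_dominates_line_typeIpm (p q : ℤ × ℤ)
    (hpq : wedge p q ≠ 0) :
    (typeIp p q →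
      ∃ G : ℝ → ℝ,
        (∀ ν : ℝ, 0 < ν →
          Tendsto (fun k : ℕ =>
              cfL ((List.range k).map fun j => ν * bcoef p q (-1 - (j : ℤ))))
            atTop (nhds (G ν))) ∧
        ∃ ν₀ > (0 : ℝ), ∀ ν : ℝ, 0 < ν → ν < ν₀ →
          G ν > ν * (nsq q) ^ 2 / (nsq p - nsq q)) ∧
    (typeIm p q →
      ∃ F : ℝ → ℝ,
        (∀ ν : ℝ, 0 < ν →
          Tendsto (fun k : ℕ =>
              cfL ((List.range k).map fun j => ν * bcoef p q (1 + (j : ℤ))))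
            atTop (nhds (F ν))) ∧
        ∃ ν₀ > (0 : ℝ), ∀ ν : ℝ, 0 < ν → ν < ν₀ →
          F ν > ν * (nsq q) ^ 2 / (nsq p - nsq q)) := by
  have hP : nsq q < nsq p → 0 < nsq p := fun h =>
    lt_of_le_of_lt (by unfold nsq; positivity) h
  constructor
  · rintro ⟨h1, _, h3⟩
    simp only [mul_div_assoc, lift_list]
    exact Cf_key (hP h1) (fun j => bcoef p q (-1 - (j : ℤ)))
      (fun j => bcoef_ge (hP h1) (h3 _ (by omega) (by omega))) _
  · rintro ⟨h1, _, h3⟩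
    simp only [mul_div_assoc, lift_list]
    exact Cf_key (hP h1) (fun j => bcoef p q (1 + (j : ℤ)))
      (fun j => bcoef_ge (hP h1) (h3 _ (by omega) (by omega))) _
end
end
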